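/- arXiv:2601.10216 — 4 statements merged into one kernel-verified Lean document; each statement's English description precedes it below -/
import Mathlib

section
/- Let δ₁, δ₂ ∈ ℝ with δ₂ ≠ 0 and λ := δ₁/δ₂ > 0, and let f : ℝ → ℝ be four times differentiable. Then f satisfies δ₂·f⁽⁴⁾(x) - 6δ₂·f⁽³⁾(x) + (11δ₂ - δ₁·exp(2x))·f''(x) + (δ₁·exp(2x) - 6δ₂)·f'(x) = 0 for all x ∈ ℝ if and only if there exist constants c₁, c₂, c₃, c₄ ∈ ℝ such that f(x) = c₁ + c₂·exp(x) + c₃·exp(√λ·exp(x)) + c₄·exp(-√λ·exp(x)) for all x ∈ ℝ. (This is the general solution, for δ₁/δ₂ > 0, of the equation characterizing the interpolating sesqui-harmonic vector fields ξ = f(x)e₁ in the paper's example on ℝ² with metric g = e^{2x}dx² + e^{2y}dy².) -/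
/-- A function whose derivative vanishes everywhere is constant. -/
lemma exists_eq_const_of_hasDerivAt_zero {g : ℝ → ℝ} (hg : ∀ x, HasDerivAt g 0 x) :
    ∃ c, ∀ x, g x = c :=
  ⟨g 0, fun x => is_const_of_deriv_eq_zero (fun y => (hg y).differentiableAt)
    (fun y => (hg y).deriv) x 0⟩

lemma hasDerivAt_exp_mul_exp (s x : ℝ) :
    HasDerivAt (fun x => Real.exp (s * Real.exp x))
      (s * Real.exp x * Real.exp (s * Real.exp x)) x := by
  refine HasDerivAt.congr_deriv (((Real.hasDerivAt_exp x).const_mul s).exp) ?_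
  ring

/-- Derivative of a polynomial in `exp x` without constant term, times `exp (s * exp x)`. -/
lemma hasDerivAt_cubic_exp_mul_exp (s a b c x : ℝ) :
    HasDerivAt
      (fun x => (a * Real.exp x + b * Real.exp x ^ 2 + c * Real.exp x ^ 3)
        * Real.exp (s * Real.exp x))
      ((a * Real.exp x + (2 * b + s * a) * Real.exp x ^ 2 + (3 * c + s * b) * Real.exp x ^ 3
        + s * c * Real.exp x ^ 4) * Real.exp (s * Real.exp x)) x := by
  have hE := Real.hasDerivAt_exp x
  refine HasDerivAt.congr_deriv ((((hE.const_mul a).add ((hE.pow 2).const_mul b)).add ((hE.pow 3).const_mul c)).mul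
    (hasDerivAt_exp_mul_exp s x)) ?_
  simp only [Pi.add_apply, Pi.pow_apply]
  push_cast
  ring

/-- Under `t = exp x` the equation below reads `F⁗ = s² F″` for `f x = F (exp x)`. -/
lemma eq_of_sesquiharmonic_ode {s : ℝ} (hs : s ≠ 0) {f f₁ f₂ f₃ f₄ : ℝ → ℝ}
    (h₁ : ∀ x, HasDerivAt f (f₁ x) x) (h₂ : ∀ x, HasDerivAt f₁ (f₂ x) x)
    (h₃ : ∀ x, HasDerivAt f₂ (f₃ x) x) (h₄ : ∀ x, HasDerivAt f₃ (f₄ x) x)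
    (hode : ∀ x, f₄ x - 6 * f₃ x + (11 - s ^ 2 * Real.exp x ^ 2) * f₂ x
      + (s ^ 2 * Real.exp x ^ 2 - 6) * f₁ x = 0) :
    ∃ c₁ c₂ c₃ c₄ : ℝ, ∀ x, f x = c₁ + c₂ * Real.exp x + c₃ * Real.exp (s * Real.exp x)
      + c₄ * Real.exp (-s * Real.exp x) := by
  set w : ℝ → ℝ := fun x => Real.exp (-x) with hw
  have hwE (x : ℝ) : w x * Real.exp x = 1 := by
    rw [hw, ← Real.exp_add, neg_add_cancel, Real.exp_zero]
  have hdw (x : ℝ) : HasDerivAt w (-w x) x := by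
    refine HasDerivAt.congr_deriv ((hasDerivAt_neg x).exp) ?_
    simp [hw]
  obtain ⟨u, hu⟩ : ∃ u : ℝ → ℝ, u = fun x => w x ^ 2 * (f₂ x - f₁ x) := ⟨_, rfl⟩
  obtain ⟨v, hv⟩ : ∃ v : ℝ → ℝ, v = fun x => w x ^ 3 * (f₃ x - 3 * f₂ x + 2 * f₁ x) := ⟨_, rfl⟩
  have hdu (x : ℝ) : HasDerivAt u (Real.exp x * v x) x := by
    rw [hu, hv]
    refine HasDerivAt.congr_deriv (((hdw x).pow 2).mul ((h₃ x).sub (h₂ x))) ?_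
    simp only [Pi.pow_apply]
    push_cast
    linear_combination (-w x ^ 2 * (f₃ x - 3 * f₂ x + 2 * f₁ x)) * hwE x
  have hdv (x : ℝ) : HasDerivAt v (s ^ 2 * (Real.exp x * u x)) x := by
    rw [hu, hv]
    refine HasDerivAt.congr_deriv (((hdw x).pow 3).mul
      (((h₄ x).sub ((h₃ x).const_mul 3)).add ((h₂ x).const_mul 2))) ?_
    simp only [Pi.pow_apply]
    push_cast
    linear_combination (w x ^ 3) * hode x
      + s ^ 2 * (f₂ x - f₁ x) * w x ^ 2 * Real.exp x * hwE x
  have first_integral (r : ℝ) (hr : r ^ 2 = s ^ 2) :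
      ∃ A, ∀ x, (v x + r * u x) * Real.exp (-r * Real.exp x) = A := by
    apply exists_eq_const_of_hasDerivAt_zero
    intro x
    refine HasDerivAt.congr_deriv (((hdv x).add ((hdu x).const_mul r)).mul (hasDerivAt_exp_mul_exp (-r) x)) ?_
    simp only [Pi.add_apply]
    linear_combination (-Real.exp x * u x * Real.exp (-r * Real.exp x)) * hr
  obtain ⟨A, hA⟩ := first_integral s rfl
  obtain ⟨B, hB⟩ := first_integral (-s) (by ring)
  obtain ⟨c₂, hc₂⟩ : ∃ c, ∀ x, w x * f₁ x - v x / s ^ 2 = c := by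
    apply exists_eq_const_of_hasDerivAt_zero
    intro x
    refine HasDerivAt.congr_deriv (((hdw x).mul (h₂ x)).sub ((hdv x).div_const (s ^ 2))) ?_
    rw [mul_div_cancel_left₀ _ (pow_ne_zero 2 hs), hu]
    linear_combination (-w x * (f₂ x - f₁ x)) * hwE x
  obtain ⟨c₁, hc₁⟩ : ∃ c, ∀ x, f x - c₂ * Real.exp x - u x / s ^ 2 = c := by
    apply exists_eq_const_of_hasDerivAt_zero
    intro x
    refine HasDerivAt.congr_deriv (((h₁ x).sub ((Real.hasDerivAt_exp x).const_mul c₂)).sub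
      ((hdu x).div_const (s ^ 2))) ?_
    linear_combination Real.exp x * hc₂ x - f₁ x * hwE x
  refine ⟨c₁, c₂, A / (2 * s ^ 3), -B / (2 * s ^ 3), fun x => ?_⟩
  have hPQ : Real.exp (s * Real.exp x) * Real.exp (-s * Real.exp x) = 1 := by
    rw [← Real.exp_add, neg_mul, add_neg_cancel, Real.exp_zero]
  have hAx := hA x
  have hBx := hB x
  rw [neg_neg] at hBx
  have hux : u x / s ^ 2 = A / (2 * s ^ 3) * Real.exp (s * Real.exp x)
      + -B / (2 * s ^ 3) * Real.exp (-s * Real.exp x) := by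
    generalize Real.exp (s * Real.exp x) = P, Real.exp (-s * Real.exp x) = Q at *
    field_simp
    linear_combination P * hAx - Q * hBx - 2 * s * u x * hPQ
  linear_combination hc₁ x + hux

theorem stmt_8 (δ₁ δ₂ : ℝ) (hδ₂ : δ₂ ≠ 0) (hlam : δ₁ / δ₂ > 0)
    (f : ℝ → ℝ) (hf : ∀ k < 4, Differentiable ℝ (iteratedDeriv k f)) :
    (∀ x : ℝ,
        δ₂ * iteratedDeriv 4 f x - 6 * δ₂ * iteratedDeriv 3 f x
          + (11 * δ₂ - δ₁ * Real.exp (2 * x)) * iteratedDeriv 2 f x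
          + (δ₁ * Real.exp (2 * x) - 6 * δ₂) * deriv f x = 0) ↔
      (∃ c₁ c₂ c₃ c₄ : ℝ, ∀ x : ℝ,
        f x = c₁ + c₂ * Real.exp x
            + c₃ * Real.exp (Real.sqrt (δ₁ / δ₂) * Real.exp x)
            + c₄ * Real.exp (-Real.sqrt (δ₁ / δ₂) * Real.exp x)) := by
  set s := Real.sqrt (δ₁ / δ₂)
  have hs : s ≠ 0 := (Real.sqrt_pos.2 hlam).ne'
  have hδ₁ : δ₁ = δ₂ * s ^ 2 := by
    rw [Real.sq_sqrt hlam.le, mul_div_cancel₀ _ hδ₂]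
  have hexp (x : ℝ) : Real.exp (2 * x) = Real.exp x ^ 2 := by
    rw [← Real.exp_nat_mul]; norm_num
  have hd (k : ℕ) (hk : k < 4) (x : ℝ) :
      HasDerivAt (iteratedDeriv k f) (iteratedDeriv (k + 1) f x) x := by
    rw [iteratedDeriv_succ]
    exact (hf k hk x).hasDerivAt
  have hd₀ (x : ℝ) : HasDerivAt f (deriv f x) x := by
    simpa using hd 0 (by norm_num) x
  have hd₁ (x : ℝ) : HasDerivAt (deriv f) (iteratedDeriv 2 f x) x := by
    simpa using hd 1 (by norm_num) x
  have hd₂ := hd 2 (by norm_num)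
  have hd₃ := hd 3 (by norm_num)
  constructor
  · intro h
    refine eq_of_sesquiharmonic_ode hs hd₀ hd₁ hd₂ hd₃ fun x => mul_left_cancel₀ hδ₂ ?_
    have hx := h x
    rw [hexp, hδ₁] at hx
    linear_combination hx
  · rintro ⟨c₁, c₂, c₃, c₄, h⟩ x
    have cubic (a b c a' b' c' x : ℝ) :=
      (((Real.hasDerivAt_exp x).const_mul c₂).add (hasDerivAt_cubic_exp_mul_exp s a b c x)).add
        (hasDerivAt_cubic_exp_mul_exp (-s) a' b' c' x)
    have e₁ : deriv f = _ := funext fun x => (hd₀ x).unique <| by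
      rw [funext h]
      exact (((Real.hasDerivAt_exp x).const_mul c₂).const_add c₁ |>.add
        ((hasDerivAt_exp_mul_exp s x).const_mul c₃)).add
        ((hasDerivAt_exp_mul_exp (-s) x).const_mul c₄)
    have e₂ : iteratedDeriv 2 f = _ := funext fun x => (hd₁ x).unique <| by
      convert cubic (c₃ * s) 0 0 (-(c₄ * s)) 0 0 x using 1
      rw [e₁]
      funext y
      simp only [Pi.add_apply]
      ring
    have e₃ : iteratedDeriv 3 f = _ := funext fun x => (hd₂ x).unique <| by
      convert cubic (c₃ * s) (c₃ * s ^ 2) 0 (-(c₄ * s)) (c₄ * s ^ 2) 0 x using 1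
      rw [e₂]
      funext y
      simp only [Pi.add_apply]
      ring
    have e₄ : iteratedDeriv 4 f = _ := funext fun x => (hd₃ x).unique <| by
      convert cubic (c₃ * s) (3 * c₃ * s ^ 2) (c₃ * s ^ 3)
        (-(c₄ * s)) (3 * c₄ * s ^ 2) (-(c₄ * s ^ 3)) x using 1
      rw [e₃]
      funext y
      simp only [Pi.add_apply]
      ring
    rw [e₁, e₂, e₃, e₄, hexp, hδ₁]
    ring
end

section
/- Let δ₁, δ₂ ∈ ℝ with δ₂ ≠ 0 and λ := δ₁/δ₂ < 0, and let f : ℝ → ℝ be four times differentiable. Then f satisfies δ₂·f⁽⁴⁾(x) - 6δ₂·f⁽³⁾(x) + (11δ₂ - δ₁·exp(2x))·f''(x) + (δ₁·exp(2x) - 6δ₂)·f'(x) = 0 for all x ∈ ℝ if and only if there exist constants c₁, c₂, c₃, c₄ ∈ ℝ such that f(x) = c₁ + c₂·exp(x) + c₃·cos(√(-λ)·exp(x)) + c₄·sin(√(-λ)·exp(x)) for all x ∈ ℝ. (This is the general solution, for δ₁/δ₂ < 0, of the equation characterizing the interpolating sesqui-harmonic vector fields ξ = f(x)e₁ in the paper's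 example on ℝ² with metric g = e^{2x}dx² + e^{2y}dy².) -/
/-- The first integrals of the equation `g'''' = -w² g''`, with `g (exp x) = f x`, determine the
solutions of the equation transported along `x ↦ exp x`. -/
lemma exists_eq_of_hasDerivAt_chain {w : ℝ} (hw : w ≠ 0) {f f₁ f₂ f₃ f₄ : ℝ → ℝ}
    (h₀ : ∀ x, HasDerivAt f (f₁ x) x) (h₁ : ∀ x, HasDerivAt f₁ (f₂ x) x)
    (h₂ : ∀ x, HasDerivAt f₂ (f₃ x) x) (h₃ : ∀ x, HasDerivAt f₃ (f₄ x) x)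
    (hode : ∀ x, f₄ x - 6 * f₃ x + (11 + w ^ 2 * Real.exp x ^ 2) * f₂ x
      - (w ^ 2 * Real.exp x ^ 2 + 6) * f₁ x = 0) :
    ∃ c₁ c₂ c₃ c₄ : ℝ, ∀ x : ℝ, f x = c₁ + c₂ * Real.exp x
      + c₃ * Real.cos (w * Real.exp x) + c₄ * Real.sin (w * Real.exp x) := by
  have const : ∀ u : ℝ → ℝ, (∀ x, HasDerivAt u 0 x) → ∀ x, u x = u 0 := fun u hu x =>
    is_const_of_deriv_eq_zero (fun y => (hu y).differentiableAt) (fun y => (hu y).deriv) x 0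
  have hexp := Real.hasDerivAt_exp
  have hinv : ∀ x, HasDerivAt (fun y => (Real.exp y)⁻¹) (-(Real.exp x)⁻¹) x := fun x => by
    refine ((hexp x).inv (Real.exp_pos x).ne').congr_deriv ?_
    field_simp
  have hcos : ∀ x, HasDerivAt (fun y => Real.cos (w * Real.exp y))
      (-Real.sin (w * Real.exp x) * (w * Real.exp x)) x := fun x => ((hexp x).const_mul w).cos
  have hsin : ∀ x, HasDerivAt (fun y => Real.sin (w * Real.exp y))
      (Real.cos (w * Real.exp x) * (w * Real.exp x)) x := fun x => ((hexp x).const_mul w).sin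
  -- `g''` and `g'''` as functions of `x`
  obtain ⟨h, hh⟩ : ∃ h : ℝ → ℝ, ∀ x, h x = (Real.exp x)⁻¹ ^ 2 * (f₂ x - f₁ x) := ⟨_, fun _ => rfl⟩
  obtain ⟨k, hk⟩ : ∃ k : ℝ → ℝ, ∀ x, k x = (Real.exp x)⁻¹ ^ 3 * (f₃ x - 3 * f₂ x + 2 * f₁ x) :=
    ⟨_, fun _ => rfl⟩
  have dh : ∀ x, HasDerivAt h (Real.exp x * k x) x := fun x => by
    rw [show h = _ from funext hh]
    refine (((hinv x).pow 2).mul ((h₂ x).sub (h₁ x))).congr_deriv ?_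
    simp [hk]
    field_simp
    ring
  have dk : ∀ x, HasDerivAt k (-(w ^ 2 * Real.exp x * h x)) x := fun x => by
    rw [show k = _ from funext hk]
    refine (((hinv x).pow 3).mul
      (((h₃ x).sub ((h₂ x).const_mul 3)).add ((h₁ x).const_mul 2))).congr_deriv ?_
    simp [hh]
    field_simp
    linear_combination hode x
  have hA := const (fun x => h x * Real.cos (w * Real.exp x) - k x / w * Real.sin (w * Real.exp x))
    fun x => by
      refine (((dh x).mul (hcos x)).sub (((dk x).div_const w).mul (hsin x))).congr_deriv ?_
      field_simp
      ring
  have hB := const (fun x => h x * Real.sin (w * Real.exp x) + k x / w * Real.cos (w * Real.exp x))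
    fun x => by
      refine (((dh x).mul (hsin x)).add (((dk x).div_const w).mul (hcos x))).congr_deriv ?_
      field_simp
      ring
  have hC := const (fun x => (Real.exp x)⁻¹ * f₁ x + k x / w ^ 2) fun x => by
    refine (((hinv x).mul (h₁ x)).add ((dk x).div_const (w ^ 2))).congr_deriv ?_
    rw [hh]
    field_simp
    ring
  generalize h 0 * Real.cos (w * Real.exp 0) - k 0 / w * Real.sin (w * Real.exp 0) = A at hA
  generalize h 0 * Real.sin (w * Real.exp 0) + k 0 / w * Real.cos (w * Real.exp 0) = B at hB
  generalize (Real.exp 0)⁻¹ * f₁ 0 + k 0 / w ^ 2 = C at hC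
  have hD := const (fun x => f x + h x / w ^ 2 - C * Real.exp x) fun x => by
    refine (((h₀ x).add ((dh x).div_const (w ^ 2))).sub ((hexp x).const_mul C)).congr_deriv ?_
    rw [← hC x]
    field_simp
    ring
  generalize f 0 + h 0 / w ^ 2 - C * Real.exp 0 = D at hD
  refine ⟨D, C, -A / w ^ 2, -B / w ^ 2, fun x => ?_⟩
  have hx : h x = A * Real.cos (w * Real.exp x) + B * Real.sin (w * Real.exp x) := by
    rw [← hA x, ← hB x]
    linear_combination -h x * Real.sin_sq_add_cos_sq (w * Real.exp x)
  have hDx := hD x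
  simp only [hx] at hDx
  linear_combination hDx

/-- The derivatives of the functions `c₁ + c₂ t + c₃ cos (w t) + c₄ sin (w t)` with `t = exp x`
satisfy the transported equation. -/
lemma iteratedDeriv_equation_of_eq {w c₁ c₂ c₃ c₄ : ℝ} {f : ℝ → ℝ}
    (hf : ∀ x : ℝ, f x = c₁ + c₂ * Real.exp x
      + c₃ * Real.cos (w * Real.exp x) + c₄ * Real.sin (w * Real.exp x)) (x : ℝ) :
    iteratedDeriv 4 f x - 6 * iteratedDeriv 3 f x
      + (11 + w ^ 2 * Real.exp x ^ 2) * iteratedDeriv 2 f x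
      - (w ^ 2 * Real.exp x ^ 2 + 6) * deriv f x = 0 := by
  have hexp := Real.hasDerivAt_exp
  have hcos : ∀ x, HasDerivAt (fun y => Real.cos (w * Real.exp y))
      (-Real.sin (w * Real.exp x) * (w * Real.exp x)) x := fun x => ((hexp x).const_mul w).cos
  have hsin : ∀ x, HasDerivAt (fun y => Real.sin (w * Real.exp y))
      (Real.cos (w * Real.exp x) * (w * Real.exp x)) x := fun x => ((hexp x).const_mul w).sin
  obtain ⟨P, hP⟩ : ∃ P : ℝ → ℝ, P = fun y =>
    c₄ * Real.cos (w * Real.exp y) - c₃ * Real.sin (w * Real.exp y) := ⟨_, rfl⟩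
  obtain ⟨Q, hQ⟩ : ∃ Q : ℝ → ℝ, Q = fun y =>
    c₃ * Real.cos (w * Real.exp y) + c₄ * Real.sin (w * Real.exp y) := ⟨_, rfl⟩
  have dP : ∀ x, HasDerivAt P (-(w * Real.exp x * Q x)) x := fun x => by
    subst hP hQ
    refine (((hcos x).const_mul c₄).sub ((hsin x).const_mul c₃)).congr_deriv ?_
    ring
  have dQ : ∀ x, HasDerivAt Q (w * Real.exp x * P x) x := fun x => by
    subst hP hQ
    refine (((hcos x).const_mul c₃).add ((hsin x).const_mul c₄)).congr_deriv ?_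
    ring
  have hf₀ : f = fun y => c₁ + c₂ * Real.exp y + Q y := by
    funext y
    rw [hf y, hQ]
    ring
  have e₁ : deriv f = fun y => c₂ * Real.exp y + w * (Real.exp y * P y) := by
    funext y
    rw [hf₀]
    refine HasDerivAt.deriv ?_
    refine ((((hexp y).const_mul c₂).const_add c₁).add (dQ y)).congr_deriv ?_
    ring
  have e₂ : iteratedDeriv 2 f = fun y =>
      c₂ * Real.exp y + w * (Real.exp y * P y) - w ^ 2 * (Real.exp y ^ 2 * Q y) := by
    funext y
    rw [iteratedDeriv_succ, iteratedDeriv_one, e₁]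
    refine HasDerivAt.deriv ?_
    refine (((hexp y).const_mul c₂).add (((hexp y).mul (dP y)).const_mul w)).congr_deriv ?_
    ring
  have e₃ : iteratedDeriv 3 f = fun y => c₂ * Real.exp y + w * (Real.exp y * P y)
      - 3 * w ^ 2 * (Real.exp y ^ 2 * Q y) - w ^ 3 * (Real.exp y ^ 3 * P y) := by
    funext y
    rw [iteratedDeriv_succ, e₂]
    refine HasDerivAt.deriv ?_
    refine ((((hexp y).const_mul c₂).add (((hexp y).mul (dP y)).const_mul w)).sub
      ((((hexp y).pow 2).mul (dQ y)).const_mul (w ^ 2))).congr_deriv ?_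
    simp
    ring
  have e₄ : iteratedDeriv 4 f = fun y => c₂ * Real.exp y + w * (Real.exp y * P y)
      - 7 * w ^ 2 * (Real.exp y ^ 2 * Q y) - 6 * w ^ 3 * (Real.exp y ^ 3 * P y)
      + w ^ 4 * (Real.exp y ^ 4 * Q y) := by
    funext y
    rw [iteratedDeriv_succ, e₃]
    refine HasDerivAt.deriv ?_
    refine (((((hexp y).const_mul c₂).add (((hexp y).mul (dP y)).const_mul w)).sub
      ((((hexp y).pow 2).mul (dQ y)).const_mul (3 * w ^ 2))).sub
      ((((hexp y).pow 3).mul (dP y)).const_mul (w ^ 3))).congr_deriv ?_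
    simp
    ring
  rw [e₁, e₂, e₃, e₄]
  ring


/-- General solution, for `λ = δ₁/δ₂ < 0`, of the interpolating
sesqui-harmonicity equation in the example on `ℝ²`. -/
theorem stmt_9 (δ₁ δ₂ : ℝ) (hδ₂ : δ₂ ≠ 0) (hlam : δ₁ / δ₂ < 0)
    (f : ℝ → ℝ) (hf : ∀ k < 4, Differentiable ℝ (iteratedDeriv k f)) :
    (∀ x : ℝ,
        δ₂ * iteratedDeriv 4 f x - 6 * δ₂ * iteratedDeriv 3 f x
          + (11 * δ₂ - δ₁ * Real.exp (2 * x)) * iteratedDeriv 2 f x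
          + (δ₁ * Real.exp (2 * x) - 6 * δ₂) * deriv f x = 0) ↔
      (∃ c₁ c₂ c₃ c₄ : ℝ, ∀ x : ℝ,
        f x = c₁ + c₂ * Real.exp x
            + c₃ * Real.cos (Real.sqrt (-(δ₁ / δ₂)) * Real.exp x)
            + c₄ * Real.sin (Real.sqrt (-(δ₁ / δ₂)) * Real.exp x)) := by
  have hw : Real.sqrt (-(δ₁ / δ₂)) ≠ 0 := (Real.sqrt_pos.2 (neg_pos.2 hlam)).ne'
  have hw2 : Real.sqrt (-(δ₁ / δ₂)) ^ 2 = -(δ₁ / δ₂) := Real.sq_sqrt (neg_pos.2 hlam).le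
  generalize Real.sqrt (-(δ₁ / δ₂)) = w at hw hw2 ⊢
  have hδ₁ : δ₁ = -(w ^ 2 * δ₂) := by
    rw [hw2]
    field_simp
  have hexp2 : ∀ x : ℝ, Real.exp (2 * x) = Real.exp x ^ 2 := fun x => by
    rw [← Real.exp_nat_mul]
    norm_num
  constructor
  · intro hode
    have hd : ∀ k < 4, ∀ x, HasDerivAt (iteratedDeriv k f) (iteratedDeriv (k + 1) f x) x :=
      fun k hk x => by
        rw [iteratedDeriv_succ]
        exact (hf k hk x).hasDerivAt
    refine exists_eq_of_hasDerivAt_chain hw (by simpa using hd 0 (by norm_num))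
      (hd 1 (by norm_num)) (hd 2 (by norm_num)) (hd 3 (by norm_num)) fun x => ?_
    have hx := hode x
    rw [hδ₁, hexp2, ← iteratedDeriv_one] at hx
    refine mul_left_cancel₀ hδ₂ ?_
    linear_combination hx
  · rintro ⟨c₁, c₂, c₃, c₄, hc⟩ x
    rw [hδ₁, hexp2]
    linear_combination δ₂ * iteratedDeriv_equation_of_eq hc x
end

section
/- Let c₁, c₂ ∈ ℝ be not both zero, and define f : ℝ → ℝ by f(x) = c₁·exp(((1-√5)/2)·x) + c₂·exp(((1+√5)/2)·x). Then f satisfies -f''(x) + f'(x) + f(x) = 0 for all x ∈ ℝ, but there exists x ∈ ℝ such that f⁽⁴⁾(x) - 2·f⁽³⁾(x) - f''(x) + 2·f'(x) + f(x) ≠ 2·f(x)³. (Hence, in the paper's example on ℝ⁴, these vector fields are harmonic vector fields but not biharmonic vector fields.) -/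
theorem deriv_add_const_mul_exp (c d a b : ℝ) :
    deriv (fun x => c * Real.exp (a * x) + d * Real.exp (b * x)) =
      fun x => c * a * Real.exp (a * x) + d * b * Real.exp (b * x) := by
  funext x
  have h (c a : ℝ) :
      HasDerivAt (fun x => c * Real.exp (a * x)) (c * a * Real.exp (a * x)) x :=
    (((hasDerivAt_id' x).const_mul a).exp.const_mul c).congr_deriv (by ring)
  exact ((h c a).add (h d b)).deriv

theorem iteratedDeriv_add_const_mul_exp (n : ℕ) (c d a b : ℝ) :
    iteratedDeriv n (fun x => c * Real.exp (a * x) + d * Real.exp (b * x)) =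
      fun x => c * a ^ n * Real.exp (a * x) + d * b ^ n * Real.exp (b * x) := by
  induction n with
  | zero => simp
  | succ n ih =>
    rw [iteratedDeriv_succ, ih, deriv_add_const_mul_exp]
    simp only [pow_succ, mul_assoc]

theorem exists_add_const_mul_exp_ne_zero {c d a b : ℝ} (hab : a ≠ b) (hc : ¬(c = 0 ∧ d = 0)) :
    ∃ x : ℝ, c * Real.exp (a * x) + d * Real.exp (b * x) ≠ 0 := by
  by_contra! h
  have h0 := h 0
  have h1 := h 1
  simp only [mul_zero, Real.exp_zero, mul_one] at h0 h1
  have hd : d = -c := by linarith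
  subst hd
  have hprod : c * (Real.exp a - Real.exp b) = 0 := by linarith
  rcases mul_eq_zero.mp hprod with h2 | h2
  · exact hc ⟨h2, by simp [h2]⟩
  · exact hab (Real.exp_injective (sub_eq_zero.mp h2))

/-- In the example on `ℝ⁴`, the harmonic vector fields
`f(x) = c₁·e^{((1-√5)/2)x} + c₂·e^{((1+√5)/2)x}` are not biharmonic. -/
theorem stmt_11 (c₁ c₂ : ℝ) (hc : ¬(c₁ = 0 ∧ c₂ = 0))
    (f : ℝ → ℝ)
    (hf : f = fun x => c₁ * Real.exp ((1 - Real.sqrt 5) / 2 * x)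
        + c₂ * Real.exp ((1 + Real.sqrt 5) / 2 * x)) :
    (∀ x : ℝ, -iteratedDeriv 2 f x + deriv f x + f x = 0) ∧
      (∃ x : ℝ,
        iteratedDeriv 4 f x - 2 * iteratedDeriv 3 f x - iteratedDeriv 2 f x
          + 2 * deriv f x + f x ≠ 2 * (f x) ^ 3) := by
  have h5 : Real.sqrt 5 ^ 2 = 5 := Real.sq_sqrt (by norm_num)
  have hpos : 0 < Real.sqrt 5 := by positivity
  have ha : ((1 - Real.sqrt 5) / 2) ^ 2 = (1 - Real.sqrt 5) / 2 + 1 := by linarith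
  have hb : ((1 + Real.sqrt 5) / 2) ^ 2 = (1 + Real.sqrt 5) / 2 + 1 := by linarith
  have hab : (1 - Real.sqrt 5) / 2 ≠ (1 + Real.sqrt 5) / 2 := by
    intro h
    linarith
  generalize (1 - Real.sqrt 5) / 2 = a at *
  generalize (1 + Real.sqrt 5) / 2 = b at *
  subst hf
  simp only [iteratedDeriv_add_const_mul_exp, deriv_add_const_mul_exp]
  constructor
  · intro x
    linear_combination -c₁ * Real.exp (a * x) * ha - c₂ * Real.exp (b * x) * hb
  · obtain ⟨x, hx⟩ := exists_add_const_mul_exp_ne_zero hab hc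
    refine ⟨x, fun h => hx (pow_eq_zero_iff (n := 3) (by norm_num) |>.mp ?_)⟩
    linear_combination -h / 2 + c₁ * Real.exp (a * x) * (a ^ 2 - a - 1) / 2 * ha
      + c₂ * Real.exp (b * x) * (b ^ 2 - b - 1) / 2 * hb
end

section
/- Let δ₁, δ₂ ∈ ℝ with δ₂ ≠ 0, let c₁, c₂ ∈ ℝ be not both zero, and define f : ℝ → ℝ by f(x) = c₁·exp(((1-√5)/2)·x) + c₂·exp(((1+√5)/2)·x). Then there exists x ∈ ℝ such that δ₂·f⁽⁴⁾(x) - 2δ₂·f⁽³⁾(x) - (δ₁+δ₂)·f''(x) + (δ₁+2δ₂)·f'(x) + (δ₁+δ₂)·f(x) ≠ 2δ₂·f(x)³. (Hence, in the paper's example on ℝ⁴, these harmonic vector fields are not interpolating sesqui-harmonic vector fields.) -/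
theorem iteratedDeriv_exp_add_exp (a b c d : ℝ) (n : ℕ) :
    iteratedDeriv n (fun x => c * Real.exp (a * x) + d * Real.exp (b * x)) =
      fun x => c * a ^ n * Real.exp (a * x) + d * b ^ n * Real.exp (b * x) := by
  induction n with
  | zero => simp
  | succ n ih =>
    rw [iteratedDeriv_succ, ih]
    funext x
    have h (r : ℝ) : HasDerivAt (fun x => Real.exp (r * x)) (Real.exp (r * x) * (r * 1)) x :=
      ((hasDerivAt_id x).const_mul r).exp
    rw [(((h a).const_mul (c * a ^ n)).fun_add ((h b).const_mul (d * b ^ n))).deriv]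
    ring

theorem exists_exp_add_exp_ne_zero {a b c d : ℝ} (hab : a ≠ b) (hc : ¬(c = 0 ∧ d = 0)) :
    ∃ x : ℝ, c * Real.exp (a * x) + d * Real.exp (b * x) ≠ 0 := by
  by_contra! h
  have h0 := h 0
  have h1 := h 1
  simp only [mul_zero, Real.exp_zero, mul_one] at h0 h1
  have hd : d = -c := by linarith
  have hprod : c * (Real.exp a - Real.exp b) = 0 := by
    rw [hd] at h1
    linarith
  rcases mul_eq_zero.mp hprod with hc0 | he
  · exact hc ⟨hc0, by linarith⟩
  · exact hab (Real.exp_injective (sub_eq_zero.mp he))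

/-- In the example on `ℝ⁴`, the harmonic vector fields
`f(x) = c₁·e^{((1-√5)/2)x} + c₂·e^{((1+√5)/2)x}` are not interpolating
sesqui-harmonic. -/
theorem stmt_12 (δ₁ δ₂ : ℝ) (hδ₂ : δ₂ ≠ 0)
    (c₁ c₂ : ℝ) (hc : ¬(c₁ = 0 ∧ c₂ = 0))
    (f : ℝ → ℝ)
    (hf : f = fun x => c₁ * Real.exp ((1 - Real.sqrt 5) / 2 * x)
        + c₂ * Real.exp ((1 + Real.sqrt 5) / 2 * x)) :
    ∃ x : ℝ,
      δ₂ * iteratedDeriv 4 f x - 2 * δ₂ * iteratedDeriv 3 f x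
        - (δ₁ + δ₂) * iteratedDeriv 2 f x + (δ₁ + 2 * δ₂) * deriv f x
        + (δ₁ + δ₂) * f x ≠ 2 * δ₂ * (f x) ^ 3 := by
  have h5 : Real.sqrt 5 ^ 2 = 5 := Real.sq_sqrt (by norm_num)
  have hpos : 0 < Real.sqrt 5 := Real.sqrt_pos.mpr (by norm_num)
  set a := (1 - Real.sqrt 5) / 2 with ha
  set b := (1 + Real.sqrt 5) / 2 with hb
  have ha2 : a ^ 2 = a + 1 := by rw [ha]; linarith
  have hb2 : b ^ 2 = b + 1 := by rw [hb]; linarith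
  have hab : a ≠ b := by
    intro h
    linarith
  have hroot (r : ℝ) (hr : r ^ 2 = r + 1) :
      δ₂ * r ^ 4 - 2 * δ₂ * r ^ 3 - (δ₁ + δ₂) * r ^ 2 + (δ₁ + 2 * δ₂) * r + (δ₁ + δ₂) = 0 := by
    linear_combination (δ₂ * (r ^ 2 - r - 1) - δ₁) * hr
  obtain ⟨x, hx⟩ := exists_exp_add_exp_ne_zero hab hc
  refine ⟨x, ?_⟩
  have hfx : f x ≠ 0 := by rwa [hf]
  have hlhs : δ₂ * iteratedDeriv 4 f x - 2 * δ₂ * iteratedDeriv 3 f x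
      - (δ₁ + δ₂) * iteratedDeriv 2 f x + (δ₁ + 2 * δ₂) * deriv f x
      + (δ₁ + δ₂) * f x = 0 := by
    rw [← iteratedDeriv_one, hf]
    simp only [iteratedDeriv_exp_add_exp]
    linear_combination c₁ * Real.exp (a * x) * hroot a ha2 + c₂ * Real.exp (b * x) * hroot b hb2
  rw [hlhs]
  exact (mul_ne_zero (mul_ne_zero two_ne_zero hδ₂) (pow_ne_zero 3 hfx)).symm
end
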